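/- arXiv:1410.4986 — 8 statements merged into one kernel-verified Lean document; each statement's English description precedes it below -/
import Mathlib

section
/- Fix thresholds η = (η_0,…,η_Q) and an index s with 2 ≤ s ≤ Q, and let g_s = max_{1≤i≤s}(η_i − η_{i−1}). Let B = {β_1 < β_2 < ⋯ < β_K} be positive integers such that any two distinct subsets of B of cardinality at most h have distinct sums. If η_s > g_s·∑_{i=max(1,K−h)}^{K} β_i, then the sequence A_s = {g_s·β_1, g_s·β_2, …, g_s·β_K} is a quantized B_h sequence with respect to η. -/
open Finset

/-- The quantization function `f_η` mapping `a` to the index of its quantization bin. -/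
def fq (η : ℕ → ℕ) (Q a : ℕ) : ℕ := Nat.findGreatest (fun r => η r ≤ a) Q

/-- `η 0 = 0 < η 1 < ⋯ < η Q` is a valid vector of thresholds. -/
def IsThresholds (η : ℕ → ℕ) (Q : ℕ) : Prop := η 0 = 0 ∧ ∀ i < Q, η i < η (i + 1)

/-- `α` (strictly increasing, positive, with all sums of at most `h` elements `< η Q`)
is a quantized `B_h` sequence with respect to `η`: all elements lie in distinct
quantization bins different from the bin of `0`, and sums of distinct subsets of
cardinality at most `h` lie in distinct bins. -/
def QuantBh (η : ℕ → ℕ) (Q : ℕ) {K : ℕ} (α : Fin K → ℕ) (h : ℕ) : Prop :=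
  StrictMono α ∧ (∀ i, 0 < α i) ∧
  (∀ S : Finset (Fin K), S.card ≤ h → ∑ i ∈ S, α i < η Q) ∧
  (∀ i, fq η Q 0 < fq η Q (α i)) ∧
  (∀ i j : Fin K, i < j → fq η Q (α i) < fq η Q (α j)) ∧
  (∀ S T : Finset (Fin K), S ≠ T → S.card ≤ h → T.card ≤ h →
    fq η Q (∑ i ∈ S, α i) ≠ fq η Q (∑ i ∈ T, α i))

/-- Adding at least the widest gap among the first `s` bins to `a < η s` changes the bin. -/
theorem fq_lt_fq {η : ℕ → ℕ} {Q s g a b : ℕ} (hη : IsThresholds η Q) (hsQ : s ≤ Q)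
    (hg : ∀ i < s, η (i + 1) ≤ η i + g) (ha : a < η s) (hab : a + g ≤ b) :
    fq η Q a < fq η Q b := by
  have hmono : ∀ i j, i ≤ j → j ≤ Q → η i ≤ η j := by
    intro i j hij
    induction j, hij using Nat.le_induction with
    | base => exact fun _ => le_rfl
    | succ j _ ih => exact fun hj => (ih (by omega)).trans (hη.2 j hj).le
  have hq : η (fq η Q a) ≤ a :=
    Nat.findGreatest_spec (P := fun r => η r ≤ a) (Nat.zero_le Q) (by simp [hη.1])
  have hqs : fq η Q a < s := by
    by_contra! h
    have := hmono s _ h (Nat.findGreatest_le Q)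
    omega
  have hb : η (fq η Q a + 1) ≤ b := by
    have := hg _ hqs
    omega
  exact Nat.le_findGreatest (P := fun r => η r ≤ b) (by omega) hb

/-- A sum of at most `h` terms of an increasing sequence is bounded by the sum of the last
`h + 1` terms. -/
theorem sum_le_sum_Icc_of_card_le {β : ℕ → ℕ} {K h : ℕ}
    (hβ : ∀ i j, 1 ≤ i → i < j → j ≤ K → β i < β j) {T : Finset ℕ}
    (hT : T ⊆ Finset.Icc 1 K) (hcard : T.card ≤ h) :
    ∑ i ∈ T, β i ≤ ∑ i ∈ Finset.Icc (max 1 (K - h)) K, β i := by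
  set m := max 1 (K - h) with hm
  set U := Finset.Icc m K with hU
  have hle : ∀ i j, 1 ≤ i → i ≤ j → j ≤ K → β i ≤ β j := by
    intro i j hi hij hj
    rcases hij.eq_or_lt with rfl | hlt
    · exact le_rfl
    · exact (hβ i j hi hlt hj).le
  have hTU : T.card ≤ U.card := by
    have := Finset.card_le_card hT
    simp only [hU, Nat.card_Icc] at this ⊢
    omega
  have hdiff : (T \ U).card ≤ (U \ T).card := by
    have h1 := Finset.card_sdiff_add_card_inter T U
    have h2 := Finset.card_sdiff_add_card_inter U T
    rw [Finset.inter_comm] at h2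
    omega
  have hlow : ∑ i ∈ T \ U, β i ≤ (T \ U).card * β m := by
    refine Finset.sum_le_card_nsmul _ _ _ fun x hx => ?_
    obtain ⟨hxT, hxU⟩ := Finset.mem_sdiff.1 hx
    have := Finset.mem_Icc.1 (hT hxT)
    simp only [hU, Finset.mem_Icc] at hxU
    exact hle x m this.1 (by omega) (by omega)
  have hhigh : (U \ T).card * β m ≤ ∑ i ∈ U \ T, β i := by
    refine Finset.card_nsmul_le_sum _ _ _ fun x hx => ?_
    have := Finset.mem_Icc.1 (Finset.mem_sdiff.1 hx).1
    exact hle m x (by omega) this.1 this.2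
  have hmul := Nat.mul_le_mul_right (β m) hdiff
  have h1 := Finset.sum_inter_add_sum_sdiff T U β
  have h2 := Finset.sum_inter_add_sum_sdiff U T β
  rw [Finset.inter_comm] at h2
  omega

theorem stmt2 (Q s h K : ℕ) (hQ : 1 ≤ Q) (η : ℕ → ℕ) (hη : IsThresholds η Q)
    (hs2 : 2 ≤ s) (hsQ : s ≤ Q)
    (g : ℕ) (hg : g = (Finset.Icc 1 s).sup fun i => η i - η (i - 1))
    (β : ℕ → ℕ)
    (hβpos : ∀ i, 1 ≤ i → i ≤ K → 0 < β i)
    (hβmono : ∀ i j, 1 ≤ i → i < j → j ≤ K → β i < β j)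
    (hβsums : ∀ S T : Finset ℕ, S ⊆ Finset.Icc 1 K → T ⊆ Finset.Icc 1 K →
      S ≠ T → S.card ≤ h → T.card ≤ h → ∑ i ∈ S, β i ≠ ∑ i ∈ T, β i)
    (hsum : g * ∑ i ∈ Finset.Icc (max 1 (K - h)) K, β i < η s) :
    QuantBh η Q (fun i : Fin K => g * β (↑i + 1)) h := by
  have hgap : ∀ i < s, η (i + 1) ≤ η i + g := by
    intro i hi
    have := Finset.le_sup (f := fun i => η i - η (i - 1))
      (Finset.mem_Icc.2 ⟨Nat.le_add_left 1 i, hi⟩)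
    rw [← hg] at this
    simp only [Nat.add_sub_cancel] at this
    omega
  have hg0 : 0 < g := by
    have h1 := hgap 0 (by omega)
    have h2 := hη.2 0 (by omega)
    omega
  have hstep : ∀ x y, g * x < η s → x < y → fq η Q (g * x) < fq η Q (g * y) :=
    fun x y hx hxy => fq_lt_fq hη hsQ hgap hx (Nat.mul_le_mul_left g hxy)
  have hηsQ : η s ≤ η Q := by
    clear hsum hstep hgap hg hs2
    induction Q, hsQ using Nat.le_induction with
    | base => exact le_rfl
    | succ n hn ih =>
      rcases Nat.eq_zero_or_pos n with rfl | hn0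
      · obtain rfl : s = 0 := by omega
        exact (hη.2 0 (by omega)).le
      · exact (ih hn0 ⟨hη.1, fun i hi => hη.2 i (by omega)⟩).trans (hη.2 n (by omega)).le
  let e : Fin K ↪ ℕ := ⟨fun i => (i : ℕ) + 1, fun i j hij => Fin.ext (Nat.succ_injective hij)⟩
  have he : ∀ S : Finset (Fin K), S.map e ⊆ Finset.Icc 1 K := by
    intro S x hx
    obtain ⟨i, -, rfl⟩ := Finset.mem_map.1 hx
    exact Finset.mem_Icc.2 ⟨Nat.le_add_left 1 _, i.2⟩
  have hsumS : ∀ S : Finset (Fin K),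
      ∑ i ∈ S, g * β (↑i + 1) = g * ∑ i ∈ S.map e, β i := by
    intro S
    rw [Finset.sum_map, Finset.mul_sum]
    rfl
  have hbound : ∀ S : Finset (Fin K), S.card ≤ h → g * ∑ i ∈ S.map e, β i < η s := by
    intro S hS
    refine (Nat.mul_le_mul_left g ?_).trans_lt hsum
    exact sum_le_sum_Icc_of_card_le hβmono (he S) (by simpa using hS)
  have hmono : ∀ i j : Fin K, i < j → β (↑i + 1) < β (↑j + 1) := fun i j hij =>
    hβmono _ _ (by omega) (Nat.succ_lt_succ hij) j.2
  have hpos : ∀ i : Fin K, 0 < β (↑i + 1) := fun i => hβpos _ (by omega) i.2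
  have hsingle : ∀ i j : Fin K, i < j → g * β (↑i + 1) < η s := by
    intro i j hij
    refine (Nat.mul_le_mul_left g ?_).trans_lt hsum
    have hjK := j.2
    have hiK : β (↑i + 1) < β K := hβmono _ _ (by omega) (by have := Fin.lt_def.1 hij; omega) le_rfl
    exact hiK.le.trans (Finset.single_le_sum (f := β) (fun _ _ => Nat.zero_le _)
      (Finset.mem_Icc.2 ⟨by omega, le_rfl⟩))
  refine ⟨fun i j hij => Nat.mul_lt_mul_of_pos_left (hmono i j hij) hg0,
    fun i => Nat.mul_pos hg0 (hpos i), fun S hS => ?_, fun i => ?_, fun i j hij => ?_,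
    fun S T hST hS hT => ?_⟩
  · rw [hsumS]
    exact (hbound S hS).trans_le hηsQ
  · simpa using hstep 0 _ (by rw [Nat.mul_zero]; omega) (hpos i)
  · exact hstep _ _ (hsingle i j hij) (hmono i j hij)
  · rw [hsumS, hsumS]
    have hne := hβsums _ _ (he S) (he T) (fun hc => hST (Finset.map_injective e hc))
      (by simpa using hS) (by simpa using hT)
    rcases hne.lt_or_gt with hlt | hlt
    · exact (hstep _ _ (hbound S hS) hlt).ne
    · exact (hstep _ _ (hbound T hT) hlt).ne'
end

section
/- A sequence of K positive integers A = {α_1 < ⋯ < α_K} (all sums of at most h of whose elements are < η_Q) is an SQLO_s(η,h) sequence if and only if both of the following hold: (1) A is a quantized B_h sequence with respect to η; (2) for every i with 1 ≤ i ≤ K and every subset A′ ⊆ {α_1, α_2, …, α_{i−1}} with |A′| ≤ h, one has α_i ≻_η ∑_{α∈A′} α. -/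
open Finset

/-- `α` (strictly increasing, positive, with all sums of at most `h` elements `< η Q`)
is an SQLO_s(η,h) sequence: elements lie in distinct bins different from the bin of `0`,
nested subsets have sums in increasing bins, and non-nested subsets are ordered according
to their largest distinct element. -/
def SQLOs (η : ℕ → ℕ) (Q : ℕ) {K : ℕ} (α : Fin K → ℕ) (h : ℕ) : Prop :=
  StrictMono α ∧ (∀ i, 0 < α i) ∧
  (∀ S : Finset (Fin K), S.card ≤ h → ∑ i ∈ S, α i < η Q) ∧
  (∀ i, fq η Q 0 < fq η Q (α i)) ∧
  (∀ i j : Fin K, i < j → fq η Q (α i) < fq η Q (α j)) ∧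
  (∀ S T : Finset (Fin K), S.Nonempty → S ⊂ T → S.card ≤ h → T.card ≤ h →
    fq η Q (∑ i ∈ S, α i) < fq η Q (∑ i ∈ T, α i)) ∧
  (∀ S T : Finset (Fin K), ¬ S ⊆ T → ¬ T ⊆ S → S.card ≤ h → T.card ≤ h →
    (∃ j ∈ T \ S, ∀ i ∈ S \ T, fq η Q (α i) < fq η Q (α j)) →
    fq η Q (∑ i ∈ S, α i) < fq η Q (∑ i ∈ T, α i))

theorem fq_mono (η : ℕ → ℕ) (Q : ℕ) : Monotone (fq η Q) := fun _ _ hab =>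
  Nat.findGreatest_mono (fun _ hr => le_trans hr hab) le_rfl

/-- Of two non-nested sets of indices, the one containing the largest element of the symmetric
difference dominates the other. -/
theorem exists_dominating_of_not_subset {ι : Type*} [LinearOrder ι] {S T : Finset ι}
    (hST : ¬ S ⊆ T) (hTS : ¬ T ⊆ S) :
    (∃ j ∈ T \ S, ∀ i ∈ S \ T, i < j) ∨ (∃ j ∈ S \ T, ∀ i ∈ T \ S, i < j) := by
  obtain ⟨a, ha, hamax⟩ := (S \ T).exists_max_image id (sdiff_nonempty.2 hST)
  obtain ⟨b, hb, hbmax⟩ := (T \ S).exists_max_image id (sdiff_nonempty.2 hTS)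
  rcases lt_trichotomy a b with hab | rfl | hab
  · exact Or.inl ⟨b, hb, fun i hi => (hamax i hi).trans_lt hab⟩
  · exact absurd (mem_sdiff.1 ha).1 (mem_sdiff.1 hb).2
  · exact Or.inr ⟨a, ha, fun i hi => (hbmax i hi).trans_lt hab⟩

theorem SQLOs.fq_zero_lt_fq_sum {η : ℕ → ℕ} {Q h K : ℕ} {α : Fin K → ℕ} (hα : SQLOs η Q α h)
    {S : Finset (Fin K)} (hS : S.Nonempty) : fq η Q 0 < fq η Q (∑ i ∈ S, α i) := by
  obtain ⟨i, hi⟩ := hS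
  exact (hα.2.2.2.1 i).trans_le
    (fq_mono η Q (single_le_sum (f := α) (fun _ _ => Nat.zero_le _) hi))

theorem SQLOs.quantBh {η : ℕ → ℕ} {Q h K : ℕ} {α : Fin K → ℕ} (hα : SQLOs η Q α h) :
    QuantBh η Q α h := by
  have hzero := fun S => hα.fq_zero_lt_fq_sum (S := S)
  obtain ⟨hmono, hpos, hsums, hbin, hbins, hnest, hdom⟩ := hα
  have hsub : ∀ S T : Finset (Fin K), S ⊂ T → S.card ≤ h → T.card ≤ h →
      fq η Q (∑ i ∈ S, α i) < fq η Q (∑ i ∈ T, α i) := by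
    intro S T hST hS hT
    rcases S.eq_empty_or_nonempty with rfl | hne
    · rw [sum_empty]
      exact hzero T (empty_ssubset.1 hST)
    · exact hnest S T hne hST hS hT
  refine ⟨hmono, hpos, hsums, hbin, hbins, fun S T hne hS hT => ?_⟩
  by_cases hST : S ⊆ T
  · exact (hsub S T (hST.ssubset_of_ne hne) hS hT).ne
  by_cases hTS : T ⊆ S
  · exact (hsub T S (hTS.ssubset_of_ne hne.symm) hT hS).ne'
  rcases exists_dominating_of_not_subset hST hTS with ⟨j, hj, hlt⟩ | ⟨j, hj, hlt⟩
  · exact (hdom S T hST hTS hS hT ⟨j, hj, fun i hi => hbins i j (hlt i hi)⟩).ne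
  · exact (hdom T S hTS hST hT hS ⟨j, hj, fun i hi => hbins i j (hlt i hi)⟩).ne'

theorem SQLOs.fq_sum_lt {η : ℕ → ℕ} {Q h K : ℕ} {α : Fin K → ℕ} (hα : SQLOs η Q α h)
    (i : Fin K) (S : Finset (Fin K)) (hlt : ∀ j ∈ S, j < i) (hS : S.card ≤ h) :
    fq η Q (∑ j ∈ S, α j) < fq η Q (α i) := by
  obtain ⟨-, -, -, hbin, hbins, -, hdom⟩ := hα
  rcases S.eq_empty_or_nonempty with rfl | hne
  · rw [sum_empty]
    exact hbin i
  have hi : i ∉ S := fun hi => (hlt i hi).false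
  have hSi : ¬ S ⊆ {i} := by
    obtain ⟨j, hj⟩ := hne
    exact fun hsub => (hlt j hj).ne (mem_singleton.1 (hsub hj))
  have hcard : ({i} : Finset (Fin K)).card ≤ h := by
    rw [card_singleton]
    exact hne.card_pos.trans_le hS
  simpa using hdom S {i} hSi (by simpa using hi) hS hcard
    ⟨i, by simpa using hi, fun j hj => hbins j i (hlt j (mem_sdiff.1 hj).1)⟩

theorem QuantBh.sqlos {η : ℕ → ℕ} {Q h K : ℕ} {α : Fin K → ℕ} (hα : QuantBh η Q α h)
    (hlt : ∀ (i : Fin K) (S : Finset (Fin K)), (∀ j ∈ S, j < i) → S.card ≤ h →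
      fq η Q (∑ j ∈ S, α j) < fq η Q (α i)) :
    SQLOs η Q α h := by
  obtain ⟨hmono, hpos, hsums, hbin, hbins, hne⟩ := hα
  refine ⟨hmono, hpos, hsums, hbin, hbins, fun S T _ hST hS hT => ?_,
    fun S T hST _ hS hT ⟨j, hj, hdom⟩ => ?_⟩
  · exact (fq_mono η Q (sum_le_sum_of_subset hST.subset)).lt_of_ne (hne S T hST.ne hS hT)
  · have hbelow : ∀ i ∈ S \ T, i < j := fun i hi =>
      hmono.lt_iff_lt.1 ((fq_mono η Q).reflect_lt (hdom i hi))
    have hdiff : ∑ i ∈ S \ T, α i < ∑ i ∈ T \ S, α i :=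
      ((fq_mono η Q).reflect_lt
        (hlt j (S \ T) hbelow ((card_le_card sdiff_subset).trans hS))).trans_le
        (single_le_sum (f := α) (fun _ _ => Nat.zero_le _) hj)
    have hsum : ∑ i ∈ S, α i ≤ ∑ i ∈ T, α i := by
      rw [← sum_inter_add_sum_sdiff S T α, ← sum_inter_add_sum_sdiff T S α, inter_comm T S]
      gcongr
    exact (fq_mono η Q hsum).lt_of_ne (hne S T (fun h => hST h.subset) hS hT)

theorem stmt4 (Q h K : ℕ) (hQ : 1 ≤ Q) (η : ℕ → ℕ) (hη : IsThresholds η Q)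
    (α : Fin K → ℕ) (hmono : StrictMono α) (hpos : ∀ i, 0 < α i)
    (hsums : ∀ S : Finset (Fin K), S.card ≤ h → ∑ i ∈ S, α i < η Q) :
    SQLOs η Q α h ↔
      (QuantBh η Q α h ∧
        ∀ (i : Fin K) (S : Finset (Fin K)), (∀ j ∈ S, j < i) → S.card ≤ h →
          fq η Q (∑ j ∈ S, α j) < fq η Q (α i)) := by
  exact ⟨fun hα => ⟨hα.quantBh, hα.fq_sum_lt⟩, fun hα => hα.1.sqlos hα.2⟩
end

section
/- Fix thresholds η = (η_0,…,η_Q) and an index s with 2 ≤ s ≤ Q, and let g_s = max_{1≤i≤s}(η_i − η_{i−1}). Let B = {β_1 < β_2 < ⋯ < β_K} be an h-superincreasing sequence. If η_s > g_s·∑_{i=max(1,K−h)}^{K} β_i, then the sequence A_s = {g_s·β_1, g_s·β_2, …, g_s·β_K} is an SQLO_s(η,h) sequence. -/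
open Finset

/-- The positive, strictly increasing sequence `β 1 < β 2 < ⋯ < β K` (1-indexed) is
`h`-superincreasing: `β j > ∑_{i = max(1, j-h)}^{j-1} β i` for every `1 < j ≤ K`. -/
def HSuperIncOn (h K : ℕ) (β : ℕ → ℕ) : Prop :=
  (∀ i, 1 ≤ i → i ≤ K → 0 < β i) ∧
  (∀ i j, 1 ≤ i → i < j → j ≤ K → β i < β j) ∧
  ∀ j, 1 < j → j ≤ K → ∑ i ∈ Finset.Ico (max 1 (j - h)) j, β i < β j

theorem fq_lt_fq_of_add_le {η : ℕ → ℕ} {Q s g a b : ℕ} (h0 : η 0 = 0) (hsQ : s ≤ Q)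
    (hgap : ∀ r < s, η (r + 1) ≤ η r + g) (hmono : ∀ r, s ≤ r → r ≤ Q → η s ≤ η r)
    (ha : a < η s) (hab : a + g ≤ b) : fq η Q a < fq η Q b := by
  have hle : η (fq η Q a) ≤ a :=
    Nat.findGreatest_spec (P := fun r => η r ≤ a) (Nat.zero_le Q) (by simp [h0])
  have hlt : fq η Q a < s := by
    by_contra! hs
    have := hmono _ hs (Nat.findGreatest_le Q)
    omega
  have hstep := hgap _ hlt
  exact Nat.le_findGreatest (P := fun r => η r ≤ b) (m := fq η Q a + 1) (by omega) (by omega)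

/-- Among the subsets of `[1, j)` with at most `h` elements, the last `h` indices maximise the
sum of a monotone sequence. -/
theorem sum_le_sum_Ico_of_card_le {β : ℕ → ℕ} {h j : ℕ} {U : Finset ℕ}
    (hβ : ∀ a b, 1 ≤ a → a ≤ b → b < j → β a ≤ β b) (hU : U ⊆ Finset.Ico 1 j)
    (hcard : U.card ≤ h) : ∑ i ∈ U, β i ≤ ∑ i ∈ Finset.Ico (max 1 (j - h)) j, β i := by
  rcases le_or_gt (j - h) 1 with hj | hj
  · rw [max_eq_left hj]
    exact Finset.sum_le_sum_of_subset hU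
  rw [max_eq_right hj.le]
  set V := Finset.Ico (j - h) j with hV
  have hVcard : V.card = h := by
    rw [hV, Nat.card_Ico]
    omega
  have hsdiff : (U \ V).card ≤ (V \ U).card := by
    have h1 := Finset.card_sdiff_add_card_inter U V
    have h2 := Finset.card_sdiff_add_card_inter V U
    rw [Finset.inter_comm] at h2
    omega
  have hlow : ∑ i ∈ U \ V, β i ≤ (U \ V).card • β (j - h) := by
    refine Finset.sum_le_card_nsmul _ _ _ fun i hi => ?_
    rw [Finset.mem_sdiff] at hi
    have h1 := Finset.mem_Ico.1 (hU hi.1)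
    have h2 := hi.2
    rw [hV, Finset.mem_Ico] at h2
    have : 0 < h := lt_of_lt_of_le (Finset.card_pos.2 ⟨i, hi.1⟩) hcard
    exact hβ _ _ h1.1 (by omega) (by omega)
  have hhigh : (V \ U).card • β (j - h) ≤ ∑ i ∈ V \ U, β i := by
    refine Finset.card_nsmul_le_sum _ _ _ fun i hi => ?_
    have h1 := (Finset.mem_sdiff.1 hi).1
    rw [hV, Finset.mem_Ico] at h1
    exact hβ _ _ hj.le h1.1 h1.2
  have hmid : (U \ V).card • β (j - h) ≤ (V \ U).card • β (j - h) :=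
    Nat.mul_le_mul_right _ hsdiff
  rw [← Finset.sum_sdiff (Finset.inter_subset_left : U ∩ V ⊆ U),
    ← Finset.sum_sdiff (Finset.inter_subset_right : U ∩ V ⊆ V), Finset.sdiff_inter_self_left,
    Finset.sdiff_inter_self_right]
  omega

theorem sum_fin_le_sum_Ico_of_card_le {β : ℕ → ℕ} {h j K : ℕ} {U : Finset (Fin K)}
    (hβ : ∀ a b, 1 ≤ a → a ≤ b → b < j → β a ≤ β b) (hU : ∀ i ∈ U, (i : ℕ) + 1 < j)
    (hcard : U.card ≤ h) :
    ∑ i ∈ U, β (i + 1) ≤ ∑ i ∈ Finset.Ico (max 1 (j - h)) j, β i := by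
  have hinj : Function.Injective fun i : Fin K => (i : ℕ) + 1 :=
    fun a b hab => Fin.ext (Nat.succ.inj hab)
  have := sum_le_sum_Ico_of_card_le (U := U.map ⟨_, hinj⟩) (h := h) hβ (fun x hx => by
    obtain ⟨i, hi, rfl⟩ := Finset.mem_map.1 hx
    exact Finset.mem_Ico.2 ⟨Nat.succ_pos _, hU i hi⟩) (by rwa [Finset.card_map])
  rwa [Finset.sum_map] at this

theorem stmt6 (Q s h K : ℕ) (hQ : 1 ≤ Q) (η : ℕ → ℕ) (hη : IsThresholds η Q)
    (hs2 : 2 ≤ s) (hsQ : s ≤ Q)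
    (g : ℕ) (hg : g = (Finset.Icc 1 s).sup fun i => η i - η (i - 1))
    (β : ℕ → ℕ) (hβ : HSuperIncOn h K β)
    (hsum : g * ∑ i ∈ Finset.Icc (max 1 (K - h)) K, β i < η s) :
    SQLOs η Q (fun i : Fin K => g * β (↑i + 1)) h := by
  obtain ⟨hpos, hinc, hsup⟩ := hβ
  have hβmono : ∀ a b, 1 ≤ a → a ≤ b → b < K + 1 → β a ≤ β b := fun a b ha hab hb =>
    hab.eq_or_lt.elim (fun he => he ▸ le_rfl) fun hlt => (hinc a b ha hlt (by omega)).le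
  have hgap : ∀ r < s, η (r + 1) ≤ η r + g := fun r hr => by
    have : η (r + 1) - η (r + 1 - 1) ≤ g :=
      hg ▸ Finset.le_sup (f := fun i => η i - η (i - 1)) (Finset.mem_Icc.2 ⟨by omega, hr⟩)
    rw [Nat.add_sub_cancel] at this
    omega
  have hmono : ∀ r, s ≤ r → r ≤ Q → η s ≤ η r := fun r hr => by
    induction r, hr using Nat.le_induction with
    | base => exact fun _ => le_rfl
    | succ r _ ih => exact fun hrQ => (ih (by omega)).trans (hη.2 r hrQ).le
  have hgpos : 0 < g := by
    have h1 := hgap 0 (by omega)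
    have h2 := hη.2 0 hQ
    omega
  have hlt_fq {a b : ℕ} (ha : g * a < η s) (hab : a < b) : fq η Q (g * a) < fq η Q (g * b) :=
    fq_lt_fq_of_add_le hη.1 hsQ hgap hmono ha (Nat.mul_le_mul_left g hab)
  have hsmall (S : Finset (Fin K)) (hS : S.card ≤ h) : g * ∑ i ∈ S, β (i + 1) < η s := by
    refine lt_of_le_of_lt (Nat.mul_le_mul_left g ?_) hsum
    refine (sum_fin_le_sum_Ico_of_card_le (j := K + 1) hβmono (fun i _ => by omega) hS).trans ?_
    refine Finset.sum_le_sum_of_subset fun x hx => ?_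
    rw [Finset.mem_Ico] at hx
    rw [Finset.mem_Icc]
    omega
  have hsingle (i : Fin K) : g * β (i + 1) < η s := by
    refine lt_of_le_of_lt (Nat.mul_le_mul_left g ?_) hsum
    refine (hβmono (i + 1) K (by omega) (by omega) (by omega)).trans ?_
    exact Finset.single_le_sum (f := β) (fun _ _ => Nat.zero_le _)
      (Finset.mem_Icc.2 ⟨by have := i.2; omega, le_rfl⟩)
  have hβpos (i : Fin K) : 0 < β (i + 1) := hpos _ (by omega) (by omega)
  have hβlt (i j : Fin K) (hij : i < j) : β (i + 1) < β (j + 1) :=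
    hinc _ _ (by omega) (by omega) (by omega)
  refine ⟨fun i j hij => Nat.mul_lt_mul_of_pos_left (hβlt i j hij) hgpos,
    fun i => Nat.mul_pos hgpos (hβpos i), fun S hS => ?_, fun i => ?_,
    fun i j hij => hlt_fq (hsingle i) (hβlt i j hij), fun S T _ hST hS _ => ?_,
    fun S T _ _ hS _ hj => ?_⟩
  · rw [← Finset.mul_sum]
    exact (hsmall S hS).trans_le (hmono Q hsQ le_rfl)
  · have := hlt_fq (a := 0) (by rw [Nat.mul_zero]; exact (Nat.zero_le _).trans_lt (hsingle i))
      (hβpos i)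
    rwa [Nat.mul_zero] at this
  · rw [← Finset.mul_sum, ← Finset.mul_sum]
    obtain ⟨j, hjT, hjS⟩ := Finset.exists_of_ssubset hST
    exact hlt_fq (hsmall S hS)
      (Finset.sum_lt_sum_of_subset hST.1 hjT hjS (hβpos j) fun _ _ _ => Nat.zero_le _)
  · obtain ⟨j, hj, hjmax⟩ := hj
    rw [← Finset.mul_sum, ← Finset.mul_sum]
    refine hlt_fq (hsmall S hS) ?_
    have hidx : ∀ i ∈ S \ T, i < j := fun i hi => by
      by_contra! hji
      refine absurd (hjmax i hi) (not_lt.2 (fq_mono η Q (Nat.mul_le_mul_left g ?_)))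
      exact hβmono _ _ (by omega) (by omega) (by omega)
    have hlow : ∑ i ∈ S \ T, β (i + 1) < β (j + 1) := by
      refine lt_of_le_of_lt (sum_fin_le_sum_Ico_of_card_le (h := h) (j := j + 1)
        (fun a b ha hab hb => hβmono a b ha hab (by omega))
        (fun i hi => by have := hidx i hi; omega)
        ((Finset.card_le_card Finset.sdiff_subset).trans hS)) ?_
      rcases Nat.eq_zero_or_pos (j : ℕ) with hj0 | hj0
      · rw [Finset.Ico_eq_empty (by omega), Finset.sum_empty]
        exact hβpos j
      · exact hsup _ (by omega) (by omega)
    have hhigh : β (j + 1) ≤ ∑ i ∈ T \ S, β (i + 1) :=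
      Finset.single_le_sum (f := fun i : Fin K => β (i + 1)) (fun _ _ => Nat.zero_le _) hj
    have hS' := Finset.sum_inter_add_sum_sdiff S T fun i : Fin K => β (i + 1)
    have hT' := Finset.sum_inter_add_sum_sdiff T S fun i : Fin K => β (i + 1)
    rw [Finset.inter_comm] at hT'
    omega
end

section
/- Fix an integer h ≥ 2. Define a sequence of positive integers by β_i = 2^{i−1} for 1 ≤ i ≤ h, and β_i = 1 + β_{i−1} + β_{i−2} + ⋯ + β_{i−h} for i > h. Then: (a) the sequence (β_i) is h-superincreasing; (b) the polynomial g(x) = x^{h+1} − 2x^h + 1 has a largest real root γ, and γ < 2 (equivalently, g(x) > 0 for all real x ≥ 2); (c) there exists a constant c > 0 such that β_K ≤ c·γ^K for every K ≥ 1. -/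
/-- The positive, strictly increasing sequence `β 1 < β 2 < ⋯` (1-indexed) is
`h`-superincreasing: `β j > ∑_{i = max(1, j-h)}^{j-1} β i` for every `j > 1`. -/
def HSuperInc (h : ℕ) (β : ℕ → ℕ) : Prop :=
  (∀ i, 1 ≤ i → 0 < β i) ∧
  (∀ i j, 1 ≤ i → i < j → β i < β j) ∧
  ∀ j, 1 < j → ∑ i ∈ Finset.Ico (max 1 (j - h)) j, β i < β j

theorem sum_Ico_two_pow_pred_lt (j : ℕ) (hj : 1 ≤ j) :
    ∑ i ∈ Finset.Ico 1 j, 2 ^ (i - 1) < 2 ^ (j - 1) := by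
  induction j, hj using Nat.le_induction with
  | base => simp
  | succ n hn ih =>
    rw [Finset.sum_Ico_succ_top hn]
    obtain ⟨m, rfl⟩ := Nat.exists_eq_add_of_le' hn
    simp only [Nat.add_sub_cancel] at *
    rw [pow_succ]
    omega

theorem hSuperInc_of_window_sum {h : ℕ} (hh : 2 ≤ h) {β : ℕ → ℕ}
    (hβ1 : ∀ i, 1 ≤ i → i ≤ h → β i = 2 ^ (i - 1))
    (hβ2 : ∀ i, h < i → β i = 1 + ∑ j ∈ Finset.Ico (i - h) i, β j) :
    HSuperInc h β := by
  have hsum : ∀ j, 1 < j → ∑ i ∈ Finset.Ico (max 1 (j - h)) j, β i < β j := by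
    intro j hj
    rcases le_or_gt j h with hjh | hjh
    · rw [max_eq_left (by omega), hβ1 j hj.le hjh]
      refine lt_of_eq_of_lt (Finset.sum_congr rfl fun i hi => ?_)
        (sum_Ico_two_pow_pred_lt j hj.le)
      rw [Finset.mem_Ico] at hi
      exact hβ1 i hi.1 (by omega)
    · rw [max_eq_right (by omega), hβ2 j hjh]
      omega
  have hstep : ∀ j, 1 ≤ j → β j < β (j + 1) := by
    intro j hj
    refine lt_of_le_of_lt ?_ (hsum (j + 1) (by omega))
    exact Finset.single_le_sum (f := β) (fun _ _ => Nat.zero_le _)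
      (Finset.mem_Ico.2 ⟨by omega, by omega⟩)
  refine ⟨fun i hi => ?_, fun i j hi hij => ?_, hsum⟩
  · rcases le_or_gt i h with hih | hih
    · rw [hβ1 i hi hih]
      positivity
    · rw [hβ2 i hih]
      omega
  · induction j, hij using Nat.le_induction with
    | base => exact hstep i hi
    | succ n hn ih => exact ih.trans (hstep n (by omega))

theorem charPoly_pos_of_two_le (h : ℕ) {x : ℝ} (hx : 2 ≤ x) :
    0 < x ^ (h + 1) - 2 * x ^ h + 1 := by
  have : 0 ≤ x ^ h * (x - 2) := mul_nonneg (by positivity) (by linarith)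
  rw [pow_succ]
  linarith

theorem exists_largest_root {h : ℕ} (hh : 2 ≤ h) :
    ∃ γ : ℝ, 1 < γ ∧ γ ^ (h + 1) - 2 * γ ^ h + 1 = 0 ∧
      ∀ x : ℝ, x ^ (h + 1) - 2 * x ^ h + 1 = 0 → x ≤ γ := by
  have hc : Continuous fun x : ℝ => x ^ (h + 1) - 2 * x ^ h + 1 := by fun_prop
  have hleft : (3 / 2 : ℝ) ^ (h + 1) - 2 * (3 / 2 : ℝ) ^ h + 1 ≤ 0 := by
    have : (3 / 2 : ℝ) ^ 2 ≤ (3 / 2 : ℝ) ^ h := pow_le_pow_right₀ (by norm_num) hh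
    rw [pow_succ]
    linarith
  obtain ⟨r, hr, hr0⟩ := intermediate_value_Icc (by norm_num : (3 / 2 : ℝ) ≤ 2)
    hc.continuousOn ⟨hleft, (charPoly_pos_of_two_le h le_rfl).le⟩
  have hcompact : IsCompact
      (Set.Icc (3 / 2 : ℝ) 2 ∩ {x : ℝ | x ^ (h + 1) - 2 * x ^ h + 1 = 0}) :=
    isCompact_Icc.inter_right (isClosed_eq hc continuous_const)
  obtain ⟨γ, ⟨hγ, hγ0⟩, hmax⟩ := hcompact.exists_isGreatest ⟨r, hr, hr0⟩
  refine ⟨γ, by linarith [hγ.1], hγ0, fun x hx => ?_⟩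
  rcases lt_or_ge x (3 / 2) with hx' | hx'
  · linarith [hγ.1]
  · rcases lt_or_ge x 2 with hx2 | hx2
    · exact hmax ⟨⟨hx', hx2.le⟩, hx⟩
    · exact absurd hx (charPoly_pos_of_two_le h hx2).ne'

theorem sum_Ico_pow_eq_pow_of_root {h : ℕ} {γ : ℝ} (hγ1 : 1 < γ)
    (hγ : γ ^ (h + 1) - 2 * γ ^ h + 1 = 0) {i : ℕ} (hi : h ≤ i) :
    ∑ j ∈ Finset.Ico (i - h) i, γ ^ j = γ ^ i := by
  obtain ⟨m, rfl⟩ := Nat.exists_eq_add_of_le' hi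
  rw [Nat.add_sub_cancel, geom_sum_Ico hγ1.ne' (by omega), div_eq_iff (by linarith)]
  linear_combination (-γ ^ m) * hγ

theorem le_const_mul_pow_of_window_sum {h : ℕ} (hh : 2 ≤ h) {β : ℕ → ℕ}
    (hβ1 : ∀ i, 1 ≤ i → i ≤ h → β i = 2 ^ (i - 1))
    (hβ2 : ∀ i, h < i → β i = 1 + ∑ j ∈ Finset.Ico (i - h) i, β j)
    {γ : ℝ} (hγ1 : 1 < γ) (hγ : γ ^ (h + 1) - 2 * γ ^ h + 1 = 0) (K : ℕ) (hK : 1 ≤ K) :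
    (β K : ℝ) + 1 ≤ (2 ^ h + 1) * γ ^ K := by
  induction K using Nat.strong_induction_on with
  | _ K ih =>
    rcases le_or_gt K h with hKh | hKh
    · rw [hβ1 K hK hKh]
      push_cast
      have h1 : (2 : ℝ) ^ (K - 1) ≤ 2 ^ h := pow_le_pow_right₀ (by norm_num) (by omega)
      have h2 : (1 : ℝ) ≤ γ ^ K := one_le_pow₀ hγ1.le
      calc (2 : ℝ) ^ (K - 1) + 1 ≤ 2 ^ h + 1 := by linarith
        _ ≤ (2 ^ h + 1) * γ ^ K := le_mul_of_one_le_right (by positivity) h2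
    · have hle : ∑ j ∈ Finset.Ico (K - h) K, ((β j : ℝ) + 1) ≤ (2 ^ h + 1) * γ ^ K := by
        rw [← sum_Ico_pow_eq_pow_of_root hγ1 hγ hKh.le, Finset.mul_sum]
        refine Finset.sum_le_sum fun j hj => ?_
        rw [Finset.mem_Ico] at hj
        exact ih j hj.2 (by omega)
      have hcard : K - (K - h) = h := by omega
      rw [Finset.sum_add_distrib, Finset.sum_const, Nat.card_Ico, hcard, nsmul_one] at hle
      have hh' : (2 : ℝ) ≤ h := by exact_mod_cast hh
      rw [hβ2 K hKh]
      push_cast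
      linarith

theorem stmt8 (h : ℕ) (hh : 2 ≤ h) (β : ℕ → ℕ)
    (hβ1 : ∀ i, 1 ≤ i → i ≤ h → β i = 2 ^ (i - 1))
    (hβ2 : ∀ i, h < i → β i = 1 + ∑ j ∈ Finset.Ico (i - h) i, β j) :
    HSuperInc h β ∧
    ∃ γ : ℝ, γ ^ (h + 1) - 2 * γ ^ h + 1 = 0 ∧
      (∀ x : ℝ, x ^ (h + 1) - 2 * x ^ h + 1 = 0 → x ≤ γ) ∧
      γ < 2 ∧ (∀ x : ℝ, 2 ≤ x → 0 < x ^ (h + 1) - 2 * x ^ h + 1) ∧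
      ∃ c : ℝ, 0 < c ∧ ∀ K : ℕ, 1 ≤ K → (β K : ℝ) ≤ c * γ ^ K := by
  obtain ⟨γ, hγ1, hγ, hmax⟩ := exists_largest_root hh
  refine ⟨hSuperInc_of_window_sum hh hβ1 hβ2, γ, hγ, hmax, ?_,
    fun x hx => charPoly_pos_of_two_le h hx, 2 ^ h + 1, by positivity, fun K hK => ?_⟩
  · by_contra! h2
    exact (charPoly_pos_of_two_le h h2).ne' hγ
  · linarith [le_const_mul_pow_of_window_sum hh hβ1 hβ2 hγ1 hγ K hK]
end

section
/- Let A = {α_1 < ⋯ < α_K} be an SQLO_s(η,d) sequence. Then: (a) for any two subsets S_1, S_2 ⊆ A with |S_1| ≤ d, |S_2| ≤ d and ∑_{α∈S_1} α = ∑_{α∈S_2} α, one has S_1 = S_2 (subset sums of size at most d are uniquely decodable); (b) for any nonempty subset S ⊆ A with |S| ≤ d and β = ∑_{α∈S} α, the largest element of A that is at most β belongs to S (correctness of the greedy knapsack step). -/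
open Finset

/-- Of two non-nested sets of indices, the one containing the maximum of their symmetric
difference has its sum in the higher bin. -/
theorem SQLOs.fq_sum_lt_of_max_mem_sdiff {η : ℕ → ℕ} {Q K h : ℕ} {α : Fin K → ℕ}
    (hA : SQLOs η Q α h) {S T : Finset (Fin K)} (hST : ¬ S ⊆ T)
    (hS : S.card ≤ h) (hT : T.card ≤ h) {j : Fin K} (hj : j ∈ T \ S)
    (hmax : ∀ i ∈ S \ T, i ≤ j) :
    fq η Q (∑ i ∈ S, α i) < fq η Q (∑ i ∈ T, α i) := by
  obtain ⟨-, -, -, -, hlt, -, hnon⟩ := hA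
  have hj' := mem_sdiff.1 hj
  refine hnon S T hST (fun hTS => hj'.2 (hTS hj'.1)) hS hT ⟨j, hj, fun i hi => hlt i j ?_⟩
  refine lt_of_le_of_ne (hmax i hi) ?_
  rintro rfl
  exact hj'.2 (mem_sdiff.1 hi).1

theorem eq_of_subset_of_sum_eq {ι : Type*} {α : ι → ℕ} (hpos : ∀ i, 0 < α i)
    {S T : Finset ι} (hST : S ⊆ T) (hsum : ∑ i ∈ S, α i = ∑ i ∈ T, α i) : S = T := by
  refine hST.antisymm fun j hjT => by_contra fun hjS => hsum.not_lt ?_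
  exact sum_lt_sum_of_subset hST hjT hjS (hpos j) fun _ _ _ => Nat.zero_le _

theorem stmt10 (Q d K : ℕ) (hQ : 1 ≤ Q) (η : ℕ → ℕ) (hη : IsThresholds η Q)
    (α : Fin K → ℕ) (hA : SQLOs η Q α d) :
    (∀ S T : Finset (Fin K), S.card ≤ d → T.card ≤ d →
      ∑ i ∈ S, α i = ∑ i ∈ T, α i → S = T) ∧
    (∀ S : Finset (Fin K), S.Nonempty → S.card ≤ d →
      ∀ i : Fin K, α i ≤ ∑ j ∈ S, α j →
        (∀ j : Fin K, α j ≤ ∑ k ∈ S, α k → α j ≤ α i) → i ∈ S) := by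
  have hpos := hA.2.1
  refine ⟨fun S T hS hT hsum => ?_, fun S hne hS i hi hmax => ?_⟩
  · by_cases hST : S ⊆ T
    · exact eq_of_subset_of_sum_eq hpos hST hsum
    by_cases hTS : T ⊆ S
    · exact (eq_of_subset_of_sum_eq hpos hTS hsum.symm).symm
    obtain ⟨i, hi, hi_max⟩ := exists_max_image (S \ T) id (sdiff_nonempty.2 hST)
    obtain ⟨j, hj, hj_max⟩ := exists_max_image (T \ S) id (sdiff_nonempty.2 hTS)
    rcases le_total i j with hij | hji
    · have := hA.fq_sum_lt_of_max_mem_sdiff hST hS hT hj fun k hk => (hi_max k hk).trans hij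
      exact absurd this (hsum ▸ lt_irrefl _)
    · have := hA.fq_sum_lt_of_max_mem_sdiff hTS hT hS hi fun k hk => (hj_max k hk).trans hji
      exact absurd this (hsum ▸ lt_irrefl _)
  · by_contra hiS
    have hle : ∀ j ∈ S, j ≤ i := fun j hj =>
      hA.1.le_iff_le.1 (hmax j (single_le_sum (fun _ _ => Nat.zero_le _) hj))
    have hsub : ¬ S ⊆ {i} := fun h => by
      obtain ⟨j, hj⟩ := hne
      exact hiS (mem_singleton.1 (h hj) ▸ hj)
    have hlt := hA.fq_sum_lt_of_max_mem_sdiff (T := {i}) hsub hS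
      ((card_singleton i).trans_le (hne.card_pos.trans_le hS)) (j := i) (by simpa using hiS)
      fun j hj => hle j (mem_sdiff.1 hj).1
    rw [sum_singleton] at hlt
    exact (fq_mono η Q hi).not_gt hlt
end

section
/- Every SQLO_l(η,h) sequence is a quantized B_h sequence with respect to η. -/
open Finset

/-- `α` (strictly increasing, positive, with all sums of at most `h` elements `< η Q`)
is an SQLO_l(η,h) sequence: elements lie in distinct bins different from the bin of `0`,
subsets of smaller cardinality have sums in smaller bins, and subsets of equal
cardinality are ordered lexicographically. -/
def SQLOl (η : ℕ → ℕ) (Q : ℕ) {K : ℕ} (α : Fin K → ℕ) (h : ℕ) : Prop :=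
  StrictMono α ∧ (∀ i, 0 < α i) ∧
  (∀ S : Finset (Fin K), S.card ≤ h → ∑ i ∈ S, α i < η Q) ∧
  (∀ i, fq η Q 0 < fq η Q (α i)) ∧
  (∀ i j : Fin K, i < j → fq η Q (α i) < fq η Q (α j)) ∧
  (∀ S T : Finset (Fin K), S.card < T.card → T.card ≤ h →
    fq η Q (∑ i ∈ S, α i) < fq η Q (∑ i ∈ T, α i)) ∧
  (∀ (s : ℕ) (S T : Finset (Fin K)) (hS : S.card = s) (hT : T.card = s),
    S ≠ T → s ≤ h →
    (∃ r : Fin s,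
      (∀ i : Fin s, i < r →
        α ((S.orderIsoOfFin hS i : Fin K)) = α ((T.orderIsoOfFin hT i : Fin K))) ∧
      fq η Q (α ((S.orderIsoOfFin hS r : Fin K))) <
        fq η Q (α ((T.orderIsoOfFin hT r : Fin K)))) →
    fq η Q (∑ i ∈ S, α i) < fq η Q (∑ i ∈ T, α i))

/-- Two distinct functions on a well-order agree up to some first argument where they differ. -/
theorem exists_first_ne {ι β : Type*} [LinearOrder ι] [WellFoundedLT ι] {f g : ι → β}
    (hfg : f ≠ g) : ∃ r, (∀ i < r, f i = g i) ∧ f r ≠ g r := by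
  obtain ⟨r, hr, hmin⟩ := wellFounded_lt.has_min {r | f r ≠ g r} (Function.ne_iff.mp hfg)
  exact ⟨r, fun i hi => by_contra fun hne => hmin i hne hi, hr⟩

/-- Distinct finsets of equal cardinality have distinct increasing enumerations. -/
theorem orderEmbOfFin_ne {ι : Type*} [LinearOrder ι] {s : ℕ} {S T : Finset ι}
    (hS : S.card = s) (hT : T.card = s) (hST : S ≠ T) :
    (S.orderEmbOfFin hS : Fin s → ι) ≠ T.orderEmbOfFin hT := by
  intro heq
  apply hST
  rw [← Finset.coe_inj, ← Finset.range_orderEmbOfFin S hS, heq, Finset.range_orderEmbOfFin]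

theorem stmt13 (Q h K : ℕ) (hQ : 1 ≤ Q) (η : ℕ → ℕ) (hη : IsThresholds η Q)
    (α : Fin K → ℕ) (hA : SQLOl η Q α h) :
    QuantBh η Q α h := by
  obtain ⟨hmono, hpos, hsum, hzero, hbin, hcard, hlex⟩ := hA
  refine ⟨hmono, hpos, hsum, hzero, hbin, fun S T hST hS hT => ?_⟩
  rcases lt_trichotomy S.card T.card with hlt | heq | hgt
  · exact (hcard S T hlt hT).ne
  · obtain ⟨r, hr, hne⟩ := exists_first_ne (orderEmbOfFin_ne heq rfl hST)
    rcases hne.lt_or_gt with hlt | hgt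
    · exact (hlex T.card S T heq rfl hST hT
        ⟨r, fun i hi => congrArg α (hr i hi), hbin _ _ hlt⟩).ne
    · exact (hlex T.card T S rfl heq hST.symm hT
        ⟨r, fun i hi => congrArg α (hr i hi).symm, hbin _ _ hgt⟩).ne'
  · exact (hcard T S hgt hS).ne'
end

section
/- Fix thresholds η = (η_0,…,η_Q) and an index s with 2 ≤ s ≤ Q, and let g_s = max_{1≤i≤s}(η_i − η_{i−1}). Let B = {β_1 < β_2 < ⋯ < β_K} be a strong-lex(h) sequence. If η_s > g_s·∑_{i=max(1,K−h)}^{K} β_i, then the sequence A_s = {g_s·β_1, g_s·β_2, …, g_s·β_K} is an SQLO_l(η,h) sequence. -/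
open Finset

/-- The sequence `β 1 < ⋯ < β K` (1-indexed) is a lex(s) sequence: for any two distinct
`s`-element subsets of `{1,…,K}`, if the increasing enumerations agree before position `r`
and the second is larger at position `r`, then the second subset has the larger sum. -/
def IsLexSeq (K s : ℕ) (β : ℕ → ℕ) : Prop :=
  ∀ (S T : Finset ℕ) (hS : S.card = s) (hT : T.card = s),
    S ⊆ Finset.Icc 1 K → T ⊆ Finset.Icc 1 K → S ≠ T →
    (∃ r : Fin s,
      (∀ i : Fin s, i < r →
        β ((S.orderIsoOfFin hS i : ℕ)) = β ((T.orderIsoOfFin hT i : ℕ))) ∧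
      β ((S.orderIsoOfFin hS r : ℕ)) < β ((T.orderIsoOfFin hT r : ℕ))) →
    ∑ i ∈ S, β i < ∑ i ∈ T, β i

/-- The sequence `β 1 < ⋯ < β K` (1-indexed) is a strong-lex(h) sequence: it is lex(s)
for every `s ≤ h`, and subsets of larger cardinality (at most `h`) have larger sums. -/
def IsStrongLex (K h : ℕ) (β : ℕ → ℕ) : Prop :=
  (∀ s, s ≤ h → IsLexSeq K s β) ∧
  ∀ S T : Finset ℕ, S ⊆ Finset.Icc 1 K → T ⊆ Finset.Icc 1 K →
    S.card < T.card → T.card ≤ h → ∑ i ∈ S, β i < ∑ i ∈ T, β i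

theorem IsThresholds.le {η : ℕ → ℕ} {Q : ℕ} (hη : IsThresholds η Q) {i j : ℕ} (hij : i ≤ j)
    (hj : j ≤ Q) : η i ≤ η j := by
  induction j, hij using Nat.le_induction with
  | base => rfl
  | succ n _ ih => exact (ih (by omega)).trans (hη.2 n (by omega)).le

/-- If `g` bounds the widths of the first `s` bins, distinct multiples of `g` below `η s` lie in
distinct bins. -/
theorem fq_mul_lt_fq_mul {η : ℕ → ℕ} {Q s g x y : ℕ} (hη : IsThresholds η Q) (hsQ : s ≤ Q)
    (hg : ∀ i < s, η (i + 1) ≤ η i + g) (hxy : x < y) (hy : g * y < η s) :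
    fq η Q (g * x) < fq η Q (g * y) := by
  have hle : g * x + g ≤ g * y := by
    calc g * x + g = g * (x + 1) := by ring
      _ ≤ g * y := Nat.mul_le_mul_left g hxy
  have hr : η (fq η Q (g * x)) ≤ g * x :=
    Nat.findGreatest_spec (P := fun r => η r ≤ g * x) (Nat.zero_le Q) (by simp [hη.1])
  have hrs : fq η Q (g * x) < s := by
    by_contra! hcon
    have := hη.le hcon (Nat.findGreatest_le Q)
    omega
  exact Nat.le_findGreatest (P := fun r => η r ≤ g * y) (hrs.trans_le hsQ)
    ((hg _ hrs).trans (by omega))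

/-- For a sequence increasing on `[1, K]`, a final segment has the largest sum among the subsets
with at most as many elements. -/
theorem sum_le_sum_Icc_of_card_le_s14 {β : ℕ → ℕ} {K m : ℕ} (hβ : MonotoneOn β (Set.Icc 1 K))
    (hm : 1 ≤ m) {S : Finset ℕ} (hS : S ⊆ Icc 1 K) (hcard : S.card ≤ (Icc m K).card) :
    ∑ i ∈ S, β i ≤ ∑ i ∈ Icc m K, β i := by
  obtain hmK | hmK := le_or_gt m K
  · have hm_mem : m ∈ Set.Icc 1 K := ⟨hm, hmK⟩
    rw [← Finset.sum_sdiff_le_sum_sdiff]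
    calc ∑ i ∈ S \ Icc m K, β i ≤ (S \ Icc m K).card • β m := by
          refine sum_le_card_nsmul _ _ _ fun i hi => ?_
          obtain ⟨hiS, hiW⟩ := mem_sdiff.1 hi
          have := mem_Icc.1 (hS hiS)
          rw [mem_Icc] at hiW
          exact hβ this hm_mem (by omega)
      _ ≤ (Icc m K \ S).card • β m :=
          Nat.mul_le_mul_right _ (card_sdiff_le_card_sdiff_iff.2 hcard)
      _ ≤ ∑ i ∈ Icc m K \ S, β i := by
          refine card_nsmul_le_sum _ _ _ fun i hi => ?_
          have := mem_Icc.1 (mem_sdiff.1 hi).1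
          exact hβ hm_mem ⟨by omega, this.2⟩ this.1
  · have : S = ∅ := by simpa [Icc_eq_empty_of_lt hmK] using hcard
    simp [this]

/-- The order embedding of `{0, …, K - 1}` onto `{1, …, K}`. -/
def finSuccEmb (K : ℕ) : Fin K ↪o ℕ :=
  OrderEmbedding.ofStrictMono (fun i => (i : ℕ) + 1) fun _ _ hij => Nat.succ_lt_succ hij

theorem map_finSuccEmb_subset {K : ℕ} (S : Finset (Fin K)) :
    S.map (finSuccEmb K).toEmbedding ⊆ Icc 1 K := by
  intro i hi
  obtain ⟨j, -, rfl⟩ := mem_map.1 hi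
  exact mem_Icc.2 ⟨Nat.succ_pos _, j.2⟩

theorem orderIsoOfFin_map {α γ : Type*} [LinearOrder α] [LinearOrder γ] (e : α ↪o γ)
    {S : Finset α} {k : ℕ} (hS : S.card = k) (hS' : (S.map e.toEmbedding).card = k) (i : Fin k) :
    ((S.map e.toEmbedding).orderIsoOfFin hS' i : γ) = e (S.orderIsoOfFin hS i) := by
  have := orderEmbOfFin_unique' hS' (f := (S.orderEmbOfFin hS).trans e)
    fun x => mem_map_of_mem _ (orderEmbOfFin_mem S hS x)
  simpa using (DFunLike.congr_fun this i).symm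

theorem stmt14 (Q s h K : ℕ) (hQ : 1 ≤ Q) (η : ℕ → ℕ) (hη : IsThresholds η Q)
    (hs2 : 2 ≤ s) (hsQ : s ≤ Q)
    (g : ℕ) (hg : g = (Finset.Icc 1 s).sup fun i => η i - η (i - 1))
    (β : ℕ → ℕ)
    (hβpos : ∀ i, 1 ≤ i → i ≤ K → 0 < β i)
    (hβmono : ∀ i j, 1 ≤ i → i < j → j ≤ K → β i < β j)
    (hlex : IsStrongLex K h β)
    (hsum : g * ∑ i ∈ Finset.Icc (max 1 (K - h)) K, β i < η s) :
    SQLOl η Q (fun i : Fin K => g * β (↑i + 1)) h := by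
  have hgap : ∀ i < s, η (i + 1) ≤ η i + g := by
    intro i hi
    have : η (i + 1) - η i ≤ g :=
      hg ▸ le_sup (f := fun i => η i - η (i - 1)) (mem_Icc.2 ⟨by omega, hi⟩ : i + 1 ∈ Icc 1 s)
    omega
  have hgpos : 0 < g := by
    have := hη.2 0 (by omega)
    have := hgap 0 (by omega)
    omega
  have hβ : MonotoneOn β (Set.Icc 1 K) := by
    intro i hi j hj hij
    obtain rfl | hij := hij.eq_or_lt
    · rfl
    · exact (hβmono i j hi.1 hij hj.2).le
  have hsmall : ∀ S ⊆ Icc 1 K, S.card ≤ h + 1 → g * ∑ i ∈ S, β i < η s := by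
    intro S hS hcard
    refine lt_of_le_of_lt (Nat.mul_le_mul_left g ?_) hsum
    refine sum_le_sum_Icc_of_card_le_s14 hβ (le_max_left _ _) hS ?_
    have := card_le_card hS
    simp only [Nat.card_Icc] at this ⊢
    omega
  have hsingle : ∀ i : Fin K, g * β (i + 1) < η s := by
    intro i
    simpa using hsmall {(i : ℕ) + 1} (by simp) (by simp)
  have hmap : ∀ S : Finset (Fin K),
      ∑ i ∈ S, g * β (i + 1) = g * ∑ i ∈ S.map (finSuccEmb K).toEmbedding, β i := by
    intro S
    rw [sum_map, mul_sum]
    rfl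
  have hstep : ∀ i j : Fin K, i < j → β (i + 1) < β (j + 1) := fun i j hij =>
    hβmono _ _ (by omega) (Nat.succ_lt_succ hij) j.2
  refine ⟨fun i j hij => Nat.mul_lt_mul_of_pos_left (hstep i j hij) hgpos,
    fun i => Nat.mul_pos hgpos (hβpos _ (by omega) i.2), ?_, ?_, ?_, ?_, ?_⟩
  · intro S hS
    rw [hmap]
    exact (hsmall _ (map_finSuccEmb_subset S) (by rw [card_map]; omega)).trans_le (hη.le hsQ le_rfl)
  · intro i
    simpa using fq_mul_lt_fq_mul hη hsQ hgap (hβpos (i + 1) (by omega) i.2) (hsingle i)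
  · exact fun i j hij => fq_mul_lt_fq_mul hη hsQ hgap (hstep i j hij) (hsingle j)
  · intro S T hST hT
    rw [hmap, hmap]
    refine fq_mul_lt_fq_mul hη hsQ hgap ?_
      (hsmall _ (map_finSuccEmb_subset T) (by rw [card_map]; omega))
    exact hlex.2 _ _ (map_finSuccEmb_subset S) (map_finSuccEmb_subset T)
      (by simpa using hST) (by simpa using hT)
  · rintro k S T hS hT hne hk ⟨r, heq, hlt⟩
    rw [hmap, hmap]
    refine fq_mul_lt_fq_mul hη hsQ hgap ?_
      (hsmall _ (map_finSuccEmb_subset T) (by rw [card_map]; omega))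
    refine hlex.1 k hk _ _ (by simpa using hS) (by simpa using hT) (map_finSuccEmb_subset S)
      (map_finSuccEmb_subset T) (by simpa using hne) ⟨r, fun i hi => ?_, ?_⟩
    · rw [orderIsoOfFin_map _ hS, orderIsoOfFin_map _ hT]
      exact Nat.eq_of_mul_eq_mul_left hgpos (heq i hi)
    · rw [orderIsoOfFin_map _ hS, orderIsoOfFin_map _ hT]
      exact Nat.lt_of_mul_lt_mul_left ((fq_mono η Q).reflect_lt hlt)
end

section
/- Let A = {α_1 < ⋯ < α_K} be an SQLO_l(η,d) sequence, and for 0 ≤ i ≤ K let γ_i = ∑_{j=1}^{i} α_j (with γ_0 = 0). Then: (a) if S ⊆ A has |S| = s with 1 ≤ s ≤ d and β = ∑_{α∈S} α, then γ_s ≤ β, and if moreover s < K and s + 1 ≤ d then β < γ_{s+1}; (b) for any i with 1 ≤ i ≤ K and any nonempty subset S ⊆ {α_i, α_{i+1}, …, α_K} with |S| = s′ ≤ d and i + s′ ≤ K, if ∑_{α∈S} α < α_{i+1} + α_{i+2} + ⋯ + α_{i+s′}, then α_i ∈ S. -/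
open Finset

theorem lt_of_fq_lt_fq {η : ℕ → ℕ} {Q a b : ℕ} (h : fq η Q a < fq η Q b) : a < b := by
  by_contra! hba
  exact h.not_ge (Nat.findGreatest_mono_left (fun _ hr => le_trans hr hba) Q)

/-- Among the sets of a given size with all indices at least `m`, the block of consecutive
indices starting at `m` has the least sum of values of a monotone function. -/
theorem sum_block_le_sum {K : ℕ} {α : Fin K → ℕ} (hα : Monotone α) (m : ℕ)
    (S : Finset (Fin K)) (hS : ∀ j ∈ S, m ≤ (j : ℕ)) :
    ∑ j ∈ univ.filter (fun j : Fin K => m ≤ (j : ℕ) ∧ (j : ℕ) < m + S.card), α j ≤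
      ∑ j ∈ S, α j := by
  induction S using Finset.induction_on_max with
  | empty => simp
  | insert a S ha ih =>
    have haS : a ∉ S := fun h => lt_irrefl _ (ha a h)
    have hS' : ∀ j ∈ S, m ≤ (j : ℕ) := fun j hj => hS j (mem_insert_of_mem hj)
    have hma : m ≤ (a : ℕ) := hS a (mem_insert_self a S)
    have hcard : S.card ≤ (a : ℕ) - m := by
      rw [← Nat.card_Ico, ← Finset.card_map Fin.valEmbedding]
      refine card_le_card fun x hx => ?_
      obtain ⟨j, hj, rfl⟩ := mem_map.1 hx
      exact mem_Ico.2 ⟨hS' j hj, ha j hj⟩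
    have hlt : m + S.card < K := by omega
    have hblock : univ.filter (fun j : Fin K => m ≤ (j : ℕ) ∧ (j : ℕ) < m + (S.card + 1)) =
        insert ⟨m + S.card, hlt⟩
          (univ.filter (fun j : Fin K => m ≤ (j : ℕ) ∧ (j : ℕ) < m + S.card)) := by
      ext j
      simp only [mem_filter, mem_univ, true_and, mem_insert, Fin.ext_iff]
      omega
    rw [card_insert_of_notMem haS, hblock, sum_insert (by simp), sum_insert haS]
    refine add_le_add (hα ?_) (ih hS')
    rw [Fin.le_def]
    change m + S.card ≤ (a : ℕ)
    omega

theorem card_filter_val_lt {K n : ℕ} (h : n ≤ K) :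
    (univ.filter (fun j : Fin K => (j : ℕ) < n)).card = n := by
  rw [Fin.card_filter_val_lt, min_eq_right h]

theorem stmt15 (Q d K : ℕ) (hQ : 1 ≤ Q) (η : ℕ → ℕ) (hη : IsThresholds η Q)
    (α : Fin K → ℕ) (hA : SQLOl η Q α d)
    (γ : ℕ → ℕ)
    (hγ : ∀ i, γ i = ∑ j ∈ univ.filter (fun j : Fin K => (j : ℕ) < i), α j) :
    (∀ S : Finset (Fin K), 1 ≤ S.card → S.card ≤ d →
      γ S.card ≤ ∑ i ∈ S, α i ∧
        (S.card < K → S.card + 1 ≤ d → ∑ i ∈ S, α i < γ (S.card + 1))) ∧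
    (∀ (i : Fin K) (S : Finset (Fin K)), S.Nonempty → (∀ j ∈ S, i ≤ j) →
      S.card ≤ d → (i : ℕ) + S.card < K →
      (∑ j ∈ S, α j <
        ∑ j ∈ univ.filter (fun j : Fin K => (i : ℕ) < (j : ℕ) ∧ (j : ℕ) ≤ (i : ℕ) + S.card), α j) →
      i ∈ S) := by
  obtain ⟨hmono, -, -, -, -, hcard, -⟩ := hA
  refine ⟨fun S _ _ => ⟨?_, fun hK hd => ?_⟩, fun i S _ hiS _ _ hlt => ?_⟩
  · simpa [hγ] using sum_block_le_sum hmono.monotone 0 S (fun j _ => Nat.zero_le _)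
  · rw [hγ]
    have hc := card_filter_val_lt (show S.card + 1 ≤ K from hK)
    exact lt_of_fq_lt_fq (hcard _ _ (by omega) (by omega))
  · by_contra hi
    refine hlt.not_ge (le_of_eq_of_le (sum_congr ?_ fun _ _ => rfl)
      (sum_block_le_sum hmono.monotone (i + 1) S fun j hj =>
        lt_of_le_of_ne (hiS j hj) fun h => hi (h ▸ hj)))
    ext j
    simp only [mem_filter, mem_univ, true_and]
    omega
end
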